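/- The functors F and G are mutually quasi-inverse: the natural transformation G∘F → Id given on each module M ∈ 𝓜_𝔩(𝔥)^× by the action map u ⊗ m ↦ u·m, and the natural transformation Id → F∘G given on each N ∈ 𝓜(𝔷)^× by n ↦ 1 ⊗ n, are isomorphisms. In particular the categories 𝓜_𝔩(𝔥)^× and 𝓜(𝔷)^× are equivalent. -/

import Mathlib

open scoped TensorProduct

structure AltBilin (k V : Type*) [Field k] [AddCommGroup V] [Module k V] where
  form : V →ₗ[k] V →ₗ[k] k
  alt : ∀ v : V, form v v = 0

variable {k V : Type*} [Field k] [AddCommGroup V] [Module k V]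

def Heisenberg (ω : AltBilin k V) : Type _ := V × k

namespace Heisenberg
variable (ω : AltBilin k V)
instance : AddCommGroup (Heisenberg ω) := inferInstanceAs (AddCommGroup (V × k))
instance : Module k (Heisenberg ω) := inferInstanceAs (Module k (V × k))
instance : LieRing (Heisenberg ω) where
  bracket x y := (((0 : V), ω.form x.1 y.1) : V × k)
  add_lie x y z := by
    show (((0 : V), ω.form (x.1 + y.1) z.1) : V × k)
      = ((0 : V), ω.form x.1 z.1) + ((0 : V), ω.form y.1 z.1)
    ext <;> simp
  lie_add x y z := by
    show (((0 : V), ω.form x.1 (y.1 + z.1)) : V × k)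
      = ((0 : V), ω.form x.1 y.1) + ((0 : V), ω.form x.1 z.1)
    ext <;> simp
  lie_self x := by
    show (((0 : V), ω.form x.1 x.1) : V × k) = 0
    ext <;> simp [ω.alt]
  leibniz_lie x y z := by
    show (((0 : V), ω.form x.1 ((0 : V), ω.form y.1 z.1).1) : V × k)
      = (((0 : V), ω.form ((0 : V), ω.form x.1 y.1).1 z.1) : V × k)
        + (((0 : V), ω.form y.1 ((0 : V), ω.form x.1 z.1).1) : V × k)
    ext <;> simp
instance : LieAlgebra k (Heisenberg ω) where
  lie_smul t x y := by
    show (((0 : V), ω.form x.1 (t • y).1) : V × k)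
      = t • (((0 : V), ω.form x.1 y.1) : V × k)
    have h1 : (t • y).1 = t • y.1 := rfl
    ext <;> simp [h1]
def zH : Heisenberg ω := (((0 : V), (1 : k)) : V × k)
def ofV (v : V) : Heisenberg ω := ((v, (0 : k)) : V × k)
def ofVk (v : V) (c : k) : Heisenberg ω := ((v, c) : V × k)
end Heisenberg

section Defs

variable (ω : AltBilin k V)
variable (M : Type*) [AddCommGroup M] [Module k M]
  [LieRingModule (Heisenberg ω) M] [LieModule k (Heisenberg ω) M]

/-- The subspace `M^𝔩` of `𝔩`-invariant vectors. -/
def invSub (l : Submodule k V) : Submodule k M where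
  carrier := {m : M | ∀ x ∈ l, ⁅Heisenberg.ofV ω x, m⁆ = 0}
  add_mem' := by
    intro a b ha hb
    intro x hx
    rw [lie_add, ha x hx, hb x hx, add_zero]
  zero_mem' := by intro x hx; simp
  smul_mem' := by
    intro c a ha
    intro x hx
    rw [lie_smul, ha x hx, smul_zero]

/-- The action of the universal enveloping algebra of `𝔥` on `M`. -/
noncomputable def uAct :
    UniversalEnvelopingAlgebra k (Heisenberg ω) →ₐ[k] Module.End k M :=
  UniversalEnvelopingAlgebra.lift k (LieModule.toEnd k (Heisenberg ω) M)

/-- The action map `α : U(𝔥) ⊗ M^𝔩 → M`, `u ⊗ m ↦ u·m`. -/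
noncomputable def alphaMap (l : Submodule k V) :
    (UniversalEnvelopingAlgebra k (Heisenberg ω) ⊗[k] ↥(invSub ω M l)) →ₗ[k] M :=
  TensorProduct.lift
    { toFun := fun u => (uAct ω M u) ∘ₗ (invSub ω M l).subtype
      map_add' := fun u v => by simp [map_add, LinearMap.add_comp]
      map_smul' := fun c u => by simp [map_smul, LinearMap.smul_comp] }

/-- The submodule of relations defining `U(𝔥) ⊗_{U(𝔭)} E(M^𝔩)` as a quotient of
`U(𝔥) ⊗_k M^𝔩`: it is spanned by the elements `(u·ι(x,c)) ⊗ m − u ⊗ (c • z·m)`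
for `x ∈ 𝔩`, `c ∈ k`, `m ∈ M^𝔩` (the `𝔭 = 𝔩 ⊕ 𝔷`-action on `E(M^𝔩)` being
trivial on `𝔩` and by the `z`-action on `𝔷`). -/
noncomputable def relSub (l : Submodule k V) :
    Submodule k (UniversalEnvelopingAlgebra k (Heisenberg ω) ⊗[k] ↥(invSub ω M l)) :=
  Submodule.span k
    {t | ∃ (u : UniversalEnvelopingAlgebra k (Heisenberg ω)) (x : V),
        x ∈ l ∧ ∃ (c : k) (m m' : ↥(invSub ω M l)),
          (m' : M) = c • ⁅Heisenberg.zH ω, (m : M)⁆ ∧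
          t = (u * UniversalEnvelopingAlgebra.ι k (Heisenberg.ofVk ω x c)) ⊗ₜ[k] m
              - u ⊗ₜ[k] m'}

end Defs

section Defs

variable (ω : AltBilin k V)
variable (N : Type*) [AddCommGroup N] [Module k N]

/-- The submodule of relations presenting `G(N) = U(𝔥) ⊗_{U(𝔭)} E(N)` as a
quotient of `U(𝔥) ⊗_k N`: it is spanned by the elements
`(u·ι(x,c)) ⊗ n − u ⊗ (c • ζ n)` for `x ∈ 𝔩`, `c ∈ k`, `n ∈ N`, where `ζ` is the
action of the central element `z` on the `𝔷`-module `N` and `𝔩` acts on `E(N)`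
by zero. -/
noncomputable def relN (l : Submodule k V) (ζ : Module.End k N) :
    Submodule k (UniversalEnvelopingAlgebra k (Heisenberg ω) ⊗[k] N) :=
  Submodule.span k
    {t | ∃ (u : UniversalEnvelopingAlgebra k (Heisenberg ω)) (x : V),
        x ∈ l ∧ ∃ (c : k) (n : N),
          t = (u * UniversalEnvelopingAlgebra.ι k (Heisenberg.ofVk ω x c)) ⊗ₜ[k] n
              - u ⊗ₜ[k] (c • ζ n)}

/-- Left multiplication by `ι(h)` on the first factor of `U(𝔥) ⊗_k N`; this
induces the `𝔥`-module structure on `G(N)`. -/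
noncomputable def lmul (h : Heisenberg ω) :
    (UniversalEnvelopingAlgebra k (Heisenberg ω) ⊗[k] N) →ₗ[k]
      (UniversalEnvelopingAlgebra k (Heisenberg ω) ⊗[k] N) :=
  TensorProduct.map (LinearMap.mulLeft k (UniversalEnvelopingAlgebra.ι k h)) LinearMap.id

end Defs

section WeylOperators

variable {M : Type*} [AddCommGroup M] [Module k M]

theorem weyl_apply_pow {D Y : Module.End k M} (h : D * Y = Y * D + 1) {c : M} (hc : D c = 0)
    (n : ℕ) : D ((Y ^ (n + 1)) c) = ((n : k) + 1) • (Y ^ n) c := by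
  have hDY : ∀ m, D (Y m) = Y (D m) + m := fun m => by
    simpa using LinearMap.congr_fun h m
  induction n with
  | zero => simp [hDY, hc]
  | succ n ih =>
    rw [pow_succ' Y (n + 1), Module.End.mul_apply, hDY, ih, map_smul, ← Module.End.mul_apply,
      ← pow_succ']
    push_cast
    module

theorem weyl_pow_apply_pow {D Y : Module.End k M} (h : D * Y = Y * D + 1) {c : M} (hc : D c = 0)
    (n : ℕ) : (D ^ n) ((Y ^ n) c) = (n.factorial : k) • c := by
  induction n with
  | zero => simp
  | succ n ih =>
    rw [pow_succ D, Module.End.mul_apply, weyl_apply_pow h hc, map_smul, ih, smul_smul,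
      Nat.factorial_succ]
    push_cast
    rfl

variable {ι : Type*} {D Y : ι → Module.End k M}

/-- A stable subspace on which the derivations act locally nilpotently is generated, under the
multiplication operators, by its vectors killed by all derivations. -/
theorem weyl_le_of_invariants_le [CharZero k] [Fintype ι] [DecidableEq ι]
    (hDY : ∀ i j, D i * Y j = Y j * D i + if i = j then 1 else 0)
    (hDD : ∀ i j, Commute (D i) (D j)) {K S : Submodule k M}
    (hKD : ∀ i, ∀ m ∈ K, D i m ∈ K) (hKY : ∀ i, ∀ m ∈ K, Y i m ∈ K)
    (hSY : ∀ i, ∀ m ∈ S, Y i m ∈ S) (hnil : ∀ i, ∀ m ∈ K, ∃ n : ℕ, (D i ^ n) m = 0)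
    (hKS : ∀ m ∈ K, (∀ i, D i m = 0) → m ∈ S) : K ≤ S := by
  have hpow : ∀ (T : Submodule k M) (A : Module.End k M), (∀ m ∈ T, A m ∈ T) →
      ∀ (n : ℕ), ∀ m ∈ T, (A ^ n) m ∈ T := by
    intro T A hA n
    induction n with
    | zero => intro m hm; simpa using hm
    | succ n ih => intro m hm; rw [pow_succ, Module.End.mul_apply]; exact ih _ (hA m hm)
  have key : ∀ s : Finset ι, ∀ m ∈ K, (∀ i ∉ s, D i m = 0) → m ∈ S := by
    intro s
    induction s using Finset.induction_on with
    | empty => intro m hm h; exact hKS m hm fun i => h i (Finset.notMem_empty i)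
    | insert j s _ ih =>
      have inner : ∀ n : ℕ, ∀ m ∈ K, (∀ i ∉ insert j s, D i m = 0) → (D j ^ n) m = 0 → m ∈ S := by
        intro n
        induction n with
        | zero => intro m _ _ h; have : m = 0 := by simpa using h
                  rw [this]; exact S.zero_mem
        | succ n ihn =>
          intro m hm hi hn
          have hjj : D j * Y j = Y j * D j + 1 := by simpa using hDY j j
          have hcK : (D j ^ n) m ∈ K := hpow K _ (hKD j) n m hm
          have hjc : D j ((D j ^ n) m) = 0 := by
            rw [← Module.End.mul_apply, ← pow_succ', hn]
          have hic : ∀ i ∉ insert j s, D i ((D j ^ n) m) = 0 := by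
            intro i his
            rw [← Module.End.mul_apply, ((hDD i j).pow_right n).eq, Module.End.mul_apply,
              hi i his, map_zero]
          have hcS : (D j ^ n) m ∈ S := by
            refine ih _ hcK fun i his => ?_
            by_cases hij : i = j
            · rw [hij, hjc]
            · exact hic i (by simp [hij, his])
          have hf : (n.factorial : k) ≠ 0 := by exact_mod_cast n.factorial_ne_zero
          have hm' : m - (n.factorial : k)⁻¹ • (Y j ^ n) ((D j ^ n) m) ∈ S := by
            refine ihn _ (K.sub_mem hm (K.smul_mem _ (hpow K _ (hKY j) n _ hcK))) ?_ ?_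
            · intro i his
              have hij : i ≠ j := fun e => his (by simp [e])
              have hcomm : Commute (D i) (Y j) := by
                have := hDY i j
                rw [if_neg hij, add_zero] at this
                exact this
              rw [map_sub, map_smul, hi i his, ← Module.End.mul_apply, (hcomm.pow_right n).eq,
                Module.End.mul_apply, hic i his]
              simp
            · rw [map_sub, map_smul, weyl_pow_apply_pow hjj hjc, smul_smul, inv_mul_cancel₀ hf,
                one_smul, sub_self]
          have := S.add_mem hm' (S.smul_mem (n.factorial : k)⁻¹ (hpow S _ (hSY j) n _ hcS))
          simpa using this
      intro m hm hi
      obtain ⟨n, hn⟩ := hnil j m hm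
      exact inner n m hm hi hn
  intro m hm
  exact key Finset.univ m hm fun i hi => absurd (Finset.mem_univ i) hi

/-- The span of the words of length `d` in the operators `Y` applied to `N`. -/
def weylDegree (Y : ι → Module.End k M) (N : Submodule k M) : ℕ → Submodule k M
  | 0 => N
  | d + 1 => ⨆ j, (weylDegree Y N d).map (Y j)

variable {N : Submodule k M}

theorem weylDegree_succ_le_comap {T : Submodule k M} {A : Module.End k M} {d : ℕ}
    (h : ∀ j, ∀ m ∈ weylDegree Y N d, A (Y j m) ∈ T) : ∀ m ∈ weylDegree Y N (d + 1), A m ∈ T := by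
  have : weylDegree Y N (d + 1) ≤ T.comap A := by
    refine iSup_le fun j => ?_
    rintro _ ⟨m, hm, rfl⟩
    exact h j m hm
  exact this

theorem weylDegree_apply_mem (j : ι) {d : ℕ} {m : M} (hm : m ∈ weylDegree Y N d) :
    Y j m ∈ weylDegree Y N (d + 1) :=
  Submodule.mem_iSup_of_mem j ⟨m, hm, rfl⟩

theorem weylDegree_apply_mem_of_commute {Z : Module.End k M} (hZY : ∀ j, Commute Z (Y j))
    (hZN : ∀ m ∈ N, Z m ∈ N) (d : ℕ) : ∀ m ∈ weylDegree Y N d, Z m ∈ weylDegree Y N d := by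
  induction d with
  | zero => exact hZN
  | succ d ih =>
    refine weylDegree_succ_le_comap fun j m hm => ?_
    rw [← Module.End.mul_apply, (hZY j).eq, Module.End.mul_apply]
    exact weylDegree_apply_mem j (ih m hm)

variable [DecidableEq ι]

theorem weylDegree_derivation_mem (hDY : ∀ i j, D i * Y j = Y j * D i + if i = j then 1 else 0)
    (hDN : ∀ i, ∀ m ∈ N, D i m = 0) (i : ι) (d : ℕ) :
    ∀ m ∈ weylDegree Y N (d + 1), D i m ∈ weylDegree Y N d := by
  have hDY' : ∀ j m, D i (Y j m) = Y j (D i m) + (if i = j then (1 : Module.End k M) else 0) m :=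
    fun j m => by simpa using LinearMap.congr_fun (hDY i j) m
  have hif : ∀ j d, ∀ m ∈ weylDegree Y N d,
      (if i = j then (1 : Module.End k M) else 0) m ∈ weylDegree Y N d := by
    intro j d m hm
    split_ifs
    · exact hm
    · exact Submodule.zero_mem _
  induction d with
  | zero =>
    refine weylDegree_succ_le_comap fun j m hm => ?_
    rw [hDY', hDN i m hm, map_zero, zero_add]
    exact hif j 0 m hm
  | succ d ih =>
    refine weylDegree_succ_le_comap fun j m hm => ?_
    rw [hDY']
    exact Submodule.add_mem _ (weylDegree_apply_mem j (ih m hm)) (hif j _ m hm)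

theorem weylDegree_derivation_pow
    (hDY : ∀ i j, D i * Y j = Y j * D i + if i = j then 1 else 0)
    (hDN : ∀ i, ∀ m ∈ N, D i m = 0) (i : ι) (d : ℕ) :
    ∀ m ∈ weylDegree Y N d, (D i ^ (d + 1)) m = 0 := by
  induction d with
  | zero => intro m hm; simpa using hDN i m hm
  | succ d ih =>
    intro m hm
    rw [pow_succ, Module.End.mul_apply]
    exact ih _ (weylDegree_derivation_mem hDY hDN i d m hm)

theorem iSup_weylDegree_eq_top
    (hDY : ∀ i j, D i * Y j = Y j * D i + if i = j then 1 else 0)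
    (hDN : ∀ i, ∀ m ∈ N, D i m = 0) {Z : Module.End k M} (hZY : ∀ j, Commute Z (Y j))
    (hZN : ∀ m ∈ N, Z m ∈ N)
    (hgen : ∀ S : Submodule k M, N ≤ S → (∀ i, ∀ m ∈ S, D i m ∈ S) → (∀ i, ∀ m ∈ S, Y i m ∈ S) →
      (∀ m ∈ S, Z m ∈ S) → S = ⊤) : ⨆ d, weylDegree Y N d = ⊤ := by
  have hstab : ∀ A : Module.End k M,
      (∀ d, ∀ m ∈ weylDegree Y N d, A m ∈ ⨆ d, weylDegree Y N d) →
      ∀ m ∈ ⨆ d, weylDegree Y N d, A m ∈ ⨆ d, weylDegree Y N d := by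
    intro A hA
    have : ⨆ d, weylDegree Y N d ≤ (⨆ d, weylDegree Y N d).comap A := iSup_le hA
    exact this
  refine hgen _ (le_iSup (weylDegree Y N) 0) (fun i => hstab _ ?_) (fun i => hstab _ ?_)
    (hstab _ ?_)
  · intro d m hm
    cases d with
    | zero => rw [hDN i m hm]; exact Submodule.zero_mem _
    | succ d => exact Submodule.mem_iSup_of_mem d (weylDegree_derivation_mem hDY hDN i d m hm)
  · intro d m hm
    exact Submodule.mem_iSup_of_mem (d + 1) (weylDegree_apply_mem i hm)
  · intro d m hm
    exact Submodule.mem_iSup_of_mem d (weylDegree_apply_mem_of_commute hZY hZN d m hm)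

theorem weyl_exists_pow_apply_eq_zero
    (hDY : ∀ i j, D i * Y j = Y j * D i + if i = j then 1 else 0)
    (hDN : ∀ i, ∀ m ∈ N, D i m = 0) (htop : ⨆ d, weylDegree Y N d = ⊤) (i : ι) (m : M) :
    ∃ n : ℕ, (D i ^ n) m = 0 := by
  have hle : ⨆ d, weylDegree Y N d ≤ (D i).maxGenEigenspace 0 := by
    refine iSup_le fun d m hm => ?_
    rw [Module.End.mem_maxGenEigenspace]
    exact ⟨d + 1, by simpa using weylDegree_derivation_pow hDY hDN i d m hm⟩
  have hm : m ∈ (D i).maxGenEigenspace 0 := hle (htop ▸ Submodule.mem_top)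
  simpa using (Module.End.mem_maxGenEigenspace _ _ _).1 hm

variable [Fintype ι]

theorem weylDegree_euler (hDY : ∀ i j, D i * Y j = Y j * D i + if i = j then 1 else 0)
    (hYY : ∀ i j, Commute (Y i) (Y j)) (hDN : ∀ i, ∀ m ∈ N, D i m = 0) (d : ℕ) :
    ∀ m ∈ weylDegree Y N d, (∑ i, Y i * D i) m = (d : k) • m := by
  have hEY : ∀ j, (∑ i, Y i * D i) * Y j = Y j * (∑ i, Y i * D i) + Y j := by
    intro j
    rw [Finset.sum_mul, Finset.mul_sum]
    have : ∀ i, Y i * D i * Y j = Y j * (Y i * D i) + if i = j then Y i else 0 := by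
      intro i
      rw [mul_assoc, hDY, mul_add, ← mul_assoc, (hYY i j).eq, mul_assoc]
      split_ifs <;> simp
    simp [this, Finset.sum_add_distrib]
  induction d with
  | zero => intro m hm; simp [fun i => hDN i m hm]
  | succ d ih =>
    have := weylDegree_succ_le_comap (Y := Y) (N := N) (T := ⊥) (d := d)
      (A := (∑ i, Y i * D i) - ((d + 1 : ℕ) : k) • 1) (fun j m hm => ?_)
    · intro m hm
      have := this m hm
      rw [Submodule.mem_bot, LinearMap.sub_apply, sub_eq_zero] at this
      simpa using this
    · rw [Submodule.mem_bot, LinearMap.sub_apply, ← Module.End.mul_apply, hEY,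
        LinearMap.add_apply, Module.End.mul_apply, ih m hm]
      simp only [map_smul, LinearMap.smul_apply, Module.End.one_apply]
      push_cast
      module

/-- Vectors killed by all derivations have degree zero. -/
theorem weyl_invariants_le [CharZero k]
    (hDY : ∀ i j, D i * Y j = Y j * D i + if i = j then 1 else 0)
    (hYY : ∀ i j, Commute (Y i) (Y j)) (hDN : ∀ i, ∀ m ∈ N, D i m = 0)
    (htop : ⨆ d, weylDegree Y N d = ⊤) {m : M} (hm : ∀ i, D i m = 0) : m ∈ N := by
  set E : Module.End k M := ∑ i, Y i * D i with hE
  have hdeg : ∀ d, weylDegree Y N d ≤ E.eigenspace (d : k) := fun d m hm =>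
    Module.End.mem_eigenspace_iff.2 (weylDegree_euler hDY hYY hDN d m hm)
  obtain ⟨f, hf, hsum⟩ := (Submodule.mem_iSup_iff_exists_finsupp _ _).1
    (show m ∈ ⨆ d, weylDegree Y N d from htop ▸ Submodule.mem_top)
  have hind := (Module.End.eigenspaces_iSupIndep E).comp (Nat.cast_injective (R := k))
  have hEm : ∑ d ∈ f.support, (d : k) • f d = 0 := by
    have h0 : E m = 0 := by simp [hE, hm]
    rw [← hsum, Finsupp.sum, map_sum] at h0
    rw [← h0]
    exact Finset.sum_congr rfl fun d _ => (weylDegree_euler hDY hYY hDN d _ (hf d)).symm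
  have hzero : ∀ d ∈ f.support, (d : k) • f d = 0 := by
    refine (iSupIndep_iff_finsetSum_eq_zero_imp_eq_zero _).1 hind _ _ (fun d _ => ?_) hEm
    exact Submodule.smul_mem _ _ (hdeg d (hf d))
  rw [← hsum]
  refine Submodule.sum_mem _ fun d hd => ?_
  rcases Nat.eq_zero_or_pos d with rfl | hpos
  · exact hf 0
  · have : f d = 0 := (smul_eq_zero.1 (hzero d hd)).resolve_left (by exact_mod_cast hpos.ne')
    rw [this]
    exact N.zero_mem

end WeylOperators

/-- A basis `x` of the Lagrangian subspace `l` together with a dual family `y` spanning a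
Lagrangian complement. -/
structure LagrangianFrame (ω : AltBilin k V) (l : Submodule k V) (ι : Type*) [Fintype ι]
    [DecidableEq ι] where
  x : ι → V
  y : ι → V
  x_mem : ∀ i, x i ∈ l
  form_x_x : ∀ i j, ω.form (x i) (x j) = 0
  form_x_y : ∀ i j, ω.form (x i) (y j) = if i = j then 1 else 0
  form_y_y : ∀ i j, ω.form (y i) (y j) = 0
  expand : ∀ v, v = ∑ i, ω.form (x i) v • y i - ∑ i, ω.form (y i) v • x i

theorem AltBilin.form_neg (ω : AltBilin k V) (v w : V) : ω.form v w = -ω.form w v :=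
  (LinearMap.IsAlt.neg (B := ω.form) ω.alt w v).symm

theorem exists_lagrangianFrame [CharZero k] [FiniteDimensional k V] (ω : AltBilin k V)
    (hnondeg : ∀ v : V, (∀ w : V, ω.form v w = 0) → v = 0)
    (l : Submodule k V) (hLag : ∀ v : V, v ∈ l ↔ ∀ x ∈ l, ω.form v x = 0) :
    Nonempty (LagrangianFrame ω l (Fin (Module.finrank k l))) := by
  have hinj : Function.Injective ω.form := by
    rw [injective_iff_map_eq_zero]
    intro v hv
    exact hnondeg v fun w => by rw [hv]; rfl
  have hsurj : Function.Surjective ω.form :=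
    (LinearMap.injective_iff_surjective_of_finrank_eq_finrank
      (Subspace.dual_finrank_eq (K := k) (V := V)).symm).1 hinj
  let b := Module.finBasis k l
  have hdual : ∀ j, ∃ y : V, ∀ i, ω.form (b i : V) y = if i = j then 1 else 0 := by
    intro j
    obtain ⟨g, hg⟩ := LinearMap.exists_extend (b.coord j)
    obtain ⟨y, hy⟩ := hsurj (-g)
    refine ⟨y, fun i => ?_⟩
    have : g (b i : V) = b.coord j (b i) := by rw [← hg]; rfl
    rw [ω.form_neg, hy, LinearMap.neg_apply, neg_neg, this, Module.Basis.coord_apply,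
      Module.Basis.repr_self, Finsupp.single_apply]
  choose y' hy' using hdual
  have hxx : ∀ i j, ω.form (b i : V) (b j : V) = 0 := fun i j =>
    (hLag _).1 (b i).2 _ (b j).2
  let y : Fin (Module.finrank k l) → V := fun j =>
    y' j - ∑ i, ((2 : k)⁻¹ * ω.form (y' j) (y' i)) • (b i : V)
  have hxy : ∀ i j, ω.form (b i : V) (y j) = if i = j then 1 else 0 := by
    intro i j
    simp [y, hy', hxx]
  have hyx : ∀ i j, ω.form (y' i) (b j : V) = if j = i then -1 else 0 := by
    intro i j
    rw [ω.form_neg, hy']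
    split_ifs <;> simp
  have hyy : ∀ i j, ω.form (y i) (y j) = 0 := by
    intro i j
    simp only [y, map_sub, map_sum, map_smul, LinearMap.sub_apply, LinearMap.sum_apply,
      LinearMap.smul_apply, hxx, hy', hyx, sub_zero, smul_eq_mul, mul_ite, mul_one, mul_zero,
      Finset.sum_ite_eq', Finset.mem_univ, if_true, Finset.sum_const_zero]
    rw [ω.form_neg (y' j) (y' i)]
    have : (2 : k) ≠ 0 := two_ne_zero
    field_simp
    ring
  have hrepr : ∀ v (hv : v ∈ l), v = ∑ i, b.repr ⟨v, hv⟩ i • (b i : V) := fun v hv => by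
    simpa only [map_sum, map_smul, Submodule.subtype_apply] using
      congrArg l.subtype (b.sum_repr ⟨v, hv⟩).symm
  have hexpand : ∀ v, v = ∑ i, ω.form (b i : V) v • y i - ∑ i, ω.form (y i) v • (b i : V) := by
    intro v
    rw [← sub_eq_zero]
    set w := v - (∑ i, ω.form (b i : V) v • y i - ∑ i, ω.form (y i) v • (b i : V)) with hw
    have hyb : ∀ i j, ω.form (y i) (b j : V) = if j = i then -1 else 0 := by
      intro i j
      rw [ω.form_neg, hxy]
      split_ifs <;> simp
    have hxw : ∀ j, ω.form (b j : V) w = 0 := by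
      intro j
      simp [hw, hxx, hxy]
    have hyw : ∀ j, ω.form (y j) w = 0 := by
      intro j
      simp [hw, hyy, hyb]
    have hwl : w ∈ l := by
      rw [hLag]
      intro u hu
      rw [hrepr u hu]
      simp [ω.form_neg w, hxw]
    have hc : ∀ j, b.repr ⟨w, hwl⟩ j = 0 := by
      intro j
      have := hyw j
      rw [hrepr w hwl] at this
      simpa [hyb] using this
    rw [hrepr w hwl]
    simp [hc]
  exact ⟨⟨fun i => b i, y, fun i => (b i).2, hxx, hxy, hyy, hexpand⟩⟩

section HeisenbergRepresentations

attribute [local instance] LieRing.ofAssociativeRing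

namespace Heisenberg

variable (ω : AltBilin k V)

theorem lie_eq_smul_zH (g h : Heisenberg ω) : ⁅g, h⁆ = ω.form g.1 h.1 • zH ω :=
  Prod.ext (smul_zero (ω.form g.1 h.1)).symm (mul_one (ω.form g.1 h.1)).symm

theorem zH_lie (h : Heisenberg ω) : ⁅zH ω, h⁆ = 0 := by
  rw [lie_eq_smul_zH]
  simp [show (zH ω).1 = 0 from rfl]

/-- The inclusion of `V` in the Heisenberg algebra, as a linear map. -/
def ofVLinear : V →ₗ[k] Heisenberg ω := LinearMap.inl k V k

theorem ofVLinear_apply (v : V) : ofVLinear ω v = ofV ω v := rfl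

theorem eq_ofV_add_smul_zH (h : Heisenberg ω) : h = ofV ω h.1 + h.2 • zH ω :=
  Prod.ext (show h.1 = h.1 + h.2 • (0 : V) by simp) (show h.2 = 0 + h.2 • (1 : k) by simp)

variable {ω} {M : Type*} [AddCommGroup M] [Module k M] (ρ : Heisenberg ω →ₗ⁅k⁆ Module.End k M)

theorem rep_mul (g h : Heisenberg ω) :
    ρ g * ρ h = ρ h * ρ g + ω.form g.1 h.1 • ρ (zH ω) := by
  have := ρ.map_lie g h
  rw [lie_eq_smul_zH, map_smul, LieRing.of_associative_ring_bracket] at this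
  rw [this]
  abel

theorem rep_zH_commute (h : Heisenberg ω) : Commute (ρ (zH ω)) (ρ h) := by
  have := rep_mul ρ (zH ω) h
  rwa [show (zH ω).1 = 0 from rfl, map_zero, LinearMap.zero_apply, zero_smul, add_zero] at this

variable {ρ} {Zi : Module.End k M}

theorem commute_inv (h₁ : Zi * ρ (zH ω) = 1) (h₂ : ρ (zH ω) * Zi = 1) (h : Heisenberg ω) :
    Commute Zi (ρ h) := by
  have hz : ρ (zH ω) * ρ h = ρ h * ρ (zH ω) := (rep_zH_commute ρ h).eq
  calc Zi * ρ h = Zi * ρ h * (ρ (zH ω) * Zi) := by rw [h₂, mul_one]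
    _ = Zi * (ρ h * ρ (zH ω)) * Zi := by simp only [mul_assoc]
    _ = (Zi * ρ (zH ω)) * (ρ h * Zi) := by rw [← hz]; simp only [mul_assoc]
    _ = ρ h * Zi := by rw [h₁, one_mul]

end Heisenberg

namespace LagrangianFrame

open Heisenberg

variable {ω : AltBilin k V} {l : Submodule k V} {ι : Type*} [Fintype ι] [DecidableEq ι]
  (F : LagrangianFrame ω l ι)

theorem eq_neg_sum_of_mem (hLag : ∀ v : V, v ∈ l ↔ ∀ x ∈ l, ω.form v x = 0) {v : V} (hv : v ∈ l) :
    v = -∑ i, ω.form (F.y i) v • F.x i := by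
  have h : ∀ i, ω.form (F.x i) v = 0 := fun i => (hLag _).1 (F.x_mem i) v hv
  have := F.expand v
  simpa [h] using this

section Representation

variable {M : Type*} [AddCommGroup M] [Module k M] {ρ : Heisenberg ω →ₗ⁅k⁆ Module.End k M}
  {Zi : Module.End k M}

variable (ρ) in
theorem rep_ofV (v : V) : ρ (ofV ω v) =
    ∑ i, ω.form (F.x i) v • ρ (ofV ω (F.y i)) - ∑ i, ω.form (F.y i) v • ρ (ofV ω (F.x i)) := by
  conv_lhs => rw [F.expand v]
  simp only [← ofVLinear_apply, map_sub, map_sum, map_smul]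

variable (ρ) in
theorem rep_ofV_apply_eq_zero (hLag : ∀ v : V, v ∈ l ↔ ∀ x ∈ l, ω.form v x = 0) {m : M}
    (hm : ∀ i, ρ (ofV ω (F.x i)) m = 0) {v : V} (hv : v ∈ l) : ρ (ofV ω v) m = 0 := by
  rw [F.eq_neg_sum_of_mem hLag hv]
  simp only [← ofVLinear_apply, map_neg, map_sum, map_smul]
  simp [ofVLinear_apply, hm]

/-- The derivations `∂ᵢ = z⁻¹ xᵢ`. -/
def derivation (ρ : Heisenberg ω →ₗ⁅k⁆ Module.End k M) (Zi : Module.End k M) (i : ι) :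
    Module.End k M :=
  Zi * ρ (ofV ω (F.x i))

theorem derivation_mul (h₁ : Zi * ρ (zH ω) = 1) (h₂ : ρ (zH ω) * Zi = 1) (i j : ι) :
    F.derivation ρ Zi i * ρ (ofV ω (F.y j)) =
      ρ (ofV ω (F.y j)) * F.derivation ρ Zi i + if i = j then 1 else 0 := by
  have hform : ω.form (ofV ω (F.x i)).1 (ofV ω (F.y j)).1 = if i = j then 1 else 0 :=
    F.form_x_y i j
  rw [derivation, mul_assoc, rep_mul, hform, mul_add, ← mul_assoc, (commute_inv h₁ h₂ _).eq,
    mul_assoc]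
  split_ifs <;> simp [h₁]

theorem derivation_commute (h₁ : Zi * ρ (zH ω) = 1) (h₂ : ρ (zH ω) * Zi = 1) (i j : ι) :
    Commute (F.derivation ρ Zi i) (F.derivation ρ Zi j) := by
  have hform : ω.form (ofV ω (F.x i)).1 (ofV ω (F.x j)).1 = 0 := F.form_x_x i j
  have hx : Commute (ρ (ofV ω (F.x i))) (ρ (ofV ω (F.x j))) := by
    have := rep_mul ρ (ofV ω (F.x i)) (ofV ω (F.x j))
    rwa [hform, zero_smul, add_zero] at this
  exact ((Commute.refl Zi).mul_right (commute_inv h₁ h₂ _)).mul_left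
    ((commute_inv h₁ h₂ _).symm.mul_right hx)

variable (ρ) in
theorem rep_y_commute (i j : ι) : Commute (ρ (ofV ω (F.y i))) (ρ (ofV ω (F.y j))) := by
  have hform : ω.form (ofV ω (F.y i)).1 (ofV ω (F.y j)).1 = 0 := F.form_y_y i j
  have := rep_mul ρ (ofV ω (F.y i)) (ofV ω (F.y j))
  rwa [hform, zero_smul, add_zero] at this

theorem rep_x_apply (h₂ : ρ (zH ω) * Zi = 1) (i : ι) (m : M) :
    ρ (ofV ω (F.x i)) m = ρ (zH ω) (F.derivation ρ Zi i m) := by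
  rw [derivation, ← Module.End.mul_apply, ← mul_assoc, h₂, one_mul]

theorem rep_mem (h₂ : ρ (zH ω) * Zi = 1) {S : Submodule k M}
    (hD : ∀ i, ∀ m ∈ S, F.derivation ρ Zi i m ∈ S)
    (hY : ∀ i, ∀ m ∈ S, ρ (ofV ω (F.y i)) m ∈ S) (hZ : ∀ m ∈ S, ρ (zH ω) m ∈ S)
    (h : Heisenberg ω) {m : M} (hm : m ∈ S) : ρ h m ∈ S := by
  rw [eq_ofV_add_smul_zH ω h, map_add, map_smul, F.rep_ofV ρ]
  simp only [LinearMap.add_apply, LinearMap.sub_apply, LinearMap.sum_apply, LinearMap.smul_apply]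
  refine S.add_mem (S.sub_mem (S.sum_mem fun i _ => S.smul_mem _ (hY i m hm))
    (S.sum_mem fun i _ => S.smul_mem _ ?_)) (S.smul_mem _ (hZ m hm))
  rw [F.rep_x_apply h₂]
  exact hZ _ (hD i m hm)

/-- Operators satisfying the canonical commutation relations define a representation of the
Heisenberg algebra. -/
def repOfCCR (X Y : ι → Module.End k M) (Z : Module.End k M) (hXX : ∀ i j, ⁅X i, X j⁆ = 0)
    (hYY : ∀ i j, ⁅Y i, Y j⁆ = 0) (hXY : ∀ i j, ⁅X i, Y j⁆ = if i = j then Z else 0)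
    (hZX : ∀ i, ⁅Z, X i⁆ = 0) (hZY : ∀ i, ⁅Z, Y i⁆ = 0) :
    Heisenberg ω →ₗ⁅k⁆ Module.End k M where
  toFun h := ∑ i, ω.form (F.x i) h.1 • Y i - ∑ i, ω.form (F.y i) h.1 • X i + h.2 • Z
  map_add' g h := by
    have h1 : (g + h).1 = g.1 + h.1 := rfl
    have h2 : (g + h).2 = g.2 + h.2 := rfl
    simp only [h1, h2, map_add, add_smul, Finset.sum_add_distrib]
    abel
  map_smul' c h := by
    have h1 : (c • h).1 = c • h.1 := rfl
    have h2 : (c • h).2 = c * h.2 := rfl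
    simp only [h1, h2, map_smul, smul_eq_mul, mul_smul, ← Finset.smul_sum, RingHom.id_apply,
      smul_add, smul_sub]
  map_lie' {g h} := by
    have h1 : ⁅g, h⁆.1 = 0 := rfl
    have h2 : ⁅g, h⁆.2 = ω.form g.1 h.1 := rfl
    have hXZ : ∀ i, ⁅X i, Z⁆ = 0 := fun i => by rw [← lie_skew, hZX, neg_zero]
    have hYZ : ∀ i, ⁅Y i, Z⁆ = 0 := fun i => by rw [← lie_skew, hZY, neg_zero]
    have hYX : ∀ i j, ⁅Y i, X j⁆ = if i = j then -Z else 0 := fun i j => by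
      rw [← lie_skew, hXY]
      by_cases hij : i = j
      · simp [hij]
      · simp [hij, Ne.symm hij]
    have hform : ω.form g.1 h.1 = ∑ i, ω.form (F.x i) g.1 * ω.form (F.y i) h.1 -
        ∑ i, ω.form (F.y i) g.1 * ω.form (F.x i) h.1 := by
      conv_lhs => rw [F.expand g.1]
      simp only [map_sub, map_sum, map_smul, LinearMap.sub_apply, LinearMap.sum_apply,
        LinearMap.smul_apply, smul_eq_mul]
    rw [h1, h2, hform]
    simp only [lie_add, add_lie, lie_sub, sub_lie, lie_sum, sum_lie, lie_smul,
      smul_lie, hXX, hYY, hXY, hYX, hZX, hZY, hXZ, hYZ, lie_self, map_zero, zero_smul, smul_zero,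
      Finset.sum_const_zero, smul_ite, Finset.sum_ite_eq', Finset.mem_univ,
      if_true, sub_smul, Finset.sum_smul, smul_neg, smul_smul, sub_zero, zero_sub, zero_add,
      add_zero, Finset.sum_neg_distrib, mul_comm (ω.form _ h.1)]
    abel

end Representation

section Model

variable (N : Type*) [AddCommGroup N] [Module k N] (ζ : Module.End k N)

/-- The operator `∂ᵢ ζ` on formal power series in divided power coordinates. -/
def powerSeriesX (i : ι) : Module.End k ((ι → ℕ) → N) where
  toFun f a := ζ (f (a + Pi.single i 1))
  map_add' f g := by ext; simp
  map_smul' c f := by ext; simp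

variable (k) in
/-- Multiplication by the `i`-th variable on formal power series in divided power coordinates. -/
def powerSeriesY (i : ι) : Module.End k ((ι → ℕ) → N) where
  toFun f a := (a i : k) • f (a - Pi.single i 1)
  map_add' f g := by ext; simp
  map_smul' c f := by ext; simp [smul_comm c]

variable (ι) in
/-- The coefficientwise action of `ζ` on formal power series. -/
def powerSeriesZ : Module.End k ((ι → ℕ) → N) where
  toFun f a := ζ (f a)
  map_add' f g := by ext; simp
  map_smul' c f := by ext; simp

variable {N}

omit [Fintype ι] in
theorem powerSeriesX_apply (i : ι) (f : (ι → ℕ) → N) (a : ι → ℕ) :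
    powerSeriesX N ζ i f a = ζ (f (a + Pi.single i 1)) := rfl

omit [Fintype ι] in
theorem powerSeriesY_apply (i : ι) (f : (ι → ℕ) → N) (a : ι → ℕ) :
    powerSeriesY k N i f a = (a i : k) • f (a - Pi.single i 1) := rfl

omit [Fintype ι] [DecidableEq ι] in
theorem powerSeriesZ_apply (f : (ι → ℕ) → N) (a : ι → ℕ) :
    powerSeriesZ ι N ζ f a = ζ (f a) := rfl

omit [Fintype ι] in
theorem powerSeries_lie_X_Y (i j : ι) :
    ⁅powerSeriesX N ζ i, powerSeriesY k N j⁆ = if i = j then powerSeriesZ ι N ζ else 0 := by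
  rw [LieRing.of_associative_ring_bracket, sub_eq_iff_eq_add]
  refine LinearMap.ext fun f => funext fun a => ?_
  have hle : a j ≠ 0 → Pi.single j 1 ≤ a := fun h0 t => by
    by_cases ht : t = j
    · subst ht
      rw [Pi.single_eq_same]
      exact Nat.one_le_iff_ne_zero.2 h0
    · simp [ht]
  by_cases hij : i = j
  · subst hij
    by_cases h0 : a i = 0
    · simp [powerSeriesX_apply, powerSeriesY_apply, powerSeriesZ_apply, h0]
    · simp only [if_true, LinearMap.add_apply, Pi.add_apply, Module.End.mul_apply,
        powerSeriesX_apply, powerSeriesY_apply, powerSeriesZ_apply, Pi.single_eq_same,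
        tsub_add_cancel_of_le (hle h0), add_tsub_cancel_right, map_smul]
      push_cast
      rw [add_smul, one_smul, add_comm]
  · by_cases h0 : a j = 0
    · simp [powerSeriesX_apply, powerSeriesY_apply, h0, hij, Ne.symm hij]
    · simp [powerSeriesX_apply, powerSeriesY_apply, hij, Ne.symm hij,
        tsub_add_eq_add_tsub (hle h0)]

variable (N)

/-- The representation of the Heisenberg algebra on formal power series with coefficients in `N`,
in divided power coordinates. -/
def powerSeriesRep : Heisenberg ω →ₗ⁅k⁆ Module.End k ((ι → ℕ) → N) :=
  F.repOfCCR (powerSeriesX N ζ) (powerSeriesY k N) (powerSeriesZ ι N ζ)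
    (fun i j => by
      rw [LieRing.of_associative_ring_bracket, sub_eq_zero]
      refine LinearMap.ext fun f => funext fun a => ?_
      simp only [Module.End.mul_apply, powerSeriesX_apply, add_right_comm])
    (fun i j => by
      rw [LieRing.of_associative_ring_bracket, sub_eq_zero]
      refine LinearMap.ext fun f => funext fun a => ?_
      by_cases hij : i = j
      · rw [hij]
      · have hc : a - Pi.single i 1 - Pi.single j 1 = a - Pi.single j 1 - Pi.single i 1 :=
          tsub_right_comm
        simp [powerSeriesY_apply, hij, Ne.symm hij, smul_smul, mul_comm, hc])
    (powerSeries_lie_X_Y ζ)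
    (fun i => by
      rw [LieRing.of_associative_ring_bracket, sub_eq_zero]
      rfl)
    (fun i => by
      rw [LieRing.of_associative_ring_bracket, sub_eq_zero]
      refine LinearMap.ext fun f => funext fun a => ?_
      simp [powerSeriesZ_apply, powerSeriesY_apply])

theorem powerSeriesRep_zH (f : (ι → ℕ) → N) (a : ι → ℕ) :
    F.powerSeriesRep N ζ (zH ω) f a = ζ (f a) := by
  simp [powerSeriesRep, repOfCCR, zH, powerSeriesZ_apply]

theorem powerSeriesRep_ofV_single (hLag : ∀ v : V, v ∈ l ↔ ∀ x ∈ l, ω.form v x = 0) {v : V}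
    (hv : v ∈ l) (n : N) : F.powerSeriesRep N ζ (ofV ω v) (Pi.single 0 n) = 0 := by
  have h : ∀ i, ω.form (F.x i) v = 0 := fun i => (hLag _).1 (F.x_mem i) v hv
  have h' : ∀ (a : ι → ℕ) i, a + Pi.single i 1 ≠ 0 := fun a i e => by
    simpa using congrFun e i
  ext a
  simp [powerSeriesRep, repOfCCR, ofV, h, h', powerSeriesX_apply]

end Model

end LagrangianFrame

/-- A subalgebra of the universal enveloping algebra containing the Lie algebra is everything. -/
theorem UniversalEnvelopingAlgebra.subalgebra_eq_top {L : Type*} [LieRing L] [LieAlgebra k L]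
    (A : Subalgebra k (UniversalEnvelopingAlgebra k L))
    (hA : ∀ x : L, UniversalEnvelopingAlgebra.ι k x ∈ A) : A = ⊤ := by
  let f : L →ₗ⁅k⁆ A :=
    { toFun := fun x => ⟨UniversalEnvelopingAlgebra.ι k x, hA x⟩
      map_add' := fun x y => Subtype.ext (map_add _ x y)
      map_smul' := fun c x => Subtype.ext (map_smul _ c x)
      map_lie' := fun {x y} => Subtype.ext ((UniversalEnvelopingAlgebra.ι k).map_lie x y) }
  have h : A.val.comp (UniversalEnvelopingAlgebra.lift k f) = AlgHom.id k _ := by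
    apply UniversalEnvelopingAlgebra.hom_ext
    ext x
    simp [f]
  refine Algebra.eq_top_iff.2 fun u => ?_
  have := AlgHom.congr_fun h u
  rw [AlgHom.comp_apply, AlgHom.id_apply] at this
  rw [← this]
  exact (UniversalEnvelopingAlgebra.lift k f u).2

open Heisenberg

section Induced

variable (ω : AltBilin k V) (N : Type*) [AddCommGroup N] [Module k N]

theorem lmul_tmul (h : Heisenberg ω) (u : UniversalEnvelopingAlgebra k (Heisenberg ω)) (n : N) :
    lmul ω N h (u ⊗ₜ[k] n) = (UniversalEnvelopingAlgebra.ι k h * u) ⊗ₜ[k] n := by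
  simp [lmul]

variable (l : Submodule k V) (ζ : Module.End k N)

theorem relN_le_comap_lmul (h : Heisenberg ω) :
    relN ω N l ζ ≤ (relN ω N l ζ).comap (lmul ω N h) := by
  refine Submodule.span_le.2 ?_
  rintro _ ⟨u, x, hx, c, n, rfl⟩
  refine Submodule.subset_span ⟨UniversalEnvelopingAlgebra.ι k h * u, x, hx, c, n, ?_⟩
  rw [map_sub, lmul_tmul, lmul_tmul, mul_assoc]

theorem relN_le_comap_lTensor {A : Module.End k N} (hA : Commute A ζ) :
    relN ω N l ζ ≤ (relN ω N l ζ).comap (A.lTensor _) := by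
  refine Submodule.span_le.2 ?_
  rintro _ ⟨u, x, hx, c, n, rfl⟩
  refine Submodule.subset_span ⟨u, x, hx, c, A n, ?_⟩
  have : A (ζ n) = ζ (A n) := LinearMap.congr_fun hA.eq n
  rw [map_sub, LinearMap.lTensor_tmul, LinearMap.lTensor_tmul, map_smul, this]

/-- The induced module `U(𝔥) ⊗_{U(𝔭)} E(N)`. -/
abbrev InducedModule : Type _ :=
  (UniversalEnvelopingAlgebra k (Heisenberg ω) ⊗[k] N) ⧸ relN ω N l ζ

/-- The Heisenberg algebra acting on the induced module. -/
noncomputable def inducedRep : Heisenberg ω →ₗ⁅k⁆ Module.End k (InducedModule ω N l ζ) where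
  toFun h := (relN ω N l ζ).mapQ _ (lmul ω N h) (relN_le_comap_lmul ω N l ζ h)
  map_add' g h := by
    ext u n
    simp [lmul_tmul, add_mul, TensorProduct.add_tmul]
  map_smul' c h := by
    ext u n
    change (relN ω N l ζ).mkQ (lmul ω N (c • h) (u ⊗ₜ[k] n)) =
      c • (relN ω N l ζ).mkQ (lmul ω N h (u ⊗ₜ[k] n))
    rw [lmul_tmul, lmul_tmul, map_smul, smul_mul_assoc, ← TensorProduct.smul_tmul', map_smul]
  map_lie' {g h} := by
    ext u n
    simp [lmul_tmul, LieRing.of_associative_ring_bracket, sub_mul, TensorProduct.sub_tmul,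
      mul_assoc]

theorem inducedRep_mk (h : Heisenberg ω)
    (t : UniversalEnvelopingAlgebra k (Heisenberg ω) ⊗[k] N) :
    inducedRep ω N l ζ h ((relN ω N l ζ).mkQ t) = (relN ω N l ζ).mkQ (lmul ω N h t) := rfl

/-- The unit map `n ↦ 1 ⊗ n`. -/
noncomputable def inducedUnit : N →ₗ[k] InducedModule ω N l ζ :=
  (relN ω N l ζ).mkQ ∘ₗ TensorProduct.mk k _ N 1

theorem inducedUnit_apply (n : N) :
    inducedUnit ω N l ζ n = (relN ω N l ζ).mkQ (1 ⊗ₜ[k] n) := rfl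

theorem mkQ_mul_ι_tmul (u : UniversalEnvelopingAlgebra k (Heisenberg ω)) {x : V} (hx : x ∈ l)
    (c : k) (n : N) :
    (relN ω N l ζ).mkQ ((u * UniversalEnvelopingAlgebra.ι k (ofVk ω x c)) ⊗ₜ[k] n) =
      (relN ω N l ζ).mkQ (u ⊗ₜ[k] (c • ζ n)) := by
  rw [← sub_eq_zero, ← map_sub, Submodule.mkQ_apply, Submodule.Quotient.mk_eq_zero]
  exact Submodule.subset_span ⟨u, x, hx, c, n, rfl⟩

theorem inducedRep_ofV_unit {x : V} (hx : x ∈ l) (n : N) :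
    inducedRep ω N l ζ (ofV ω x) (inducedUnit ω N l ζ n) = 0 := by
  have := mkQ_mul_ι_tmul ω N l ζ 1 hx 0 n
  rw [zero_smul, TensorProduct.tmul_zero, map_zero, one_mul] at this
  rw [inducedUnit_apply, inducedRep_mk, lmul_tmul, mul_one]
  exact this

theorem inducedRep_zH : inducedRep ω N l ζ (zH ω) =
    (relN ω N l ζ).mapQ _ (ζ.lTensor _) (relN_le_comap_lTensor ω N l ζ (Commute.refl ζ)) := by
  ext u n
  have hz : UniversalEnvelopingAlgebra.ι k (zH ω) * u =
      u * UniversalEnvelopingAlgebra.ι k (zH ω) := by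
    have htop := UniversalEnvelopingAlgebra.subalgebra_eq_top (k := k)
      (Subalgebra.centralizer k {UniversalEnvelopingAlgebra.ι k (zH ω)}) (fun h => ?_)
    · have hu : u ∈ Subalgebra.centralizer k {UniversalEnvelopingAlgebra.ι k (zH ω)} :=
        htop ▸ Algebra.mem_top
      exact (Subalgebra.mem_centralizer_iff k).1 hu _ rfl
    · rw [Subalgebra.mem_centralizer_iff]
      rintro _ rfl
      have := (UniversalEnvelopingAlgebra.ι k).map_lie (zH ω) h
      rw [zH_lie, map_zero, LieRing.of_associative_ring_bracket] at this
      exact (sub_eq_zero.1 this.symm)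
  have := mkQ_mul_ι_tmul ω N l ζ u l.zero_mem 1 n
  rw [one_smul] at this
  change (relN ω N l ζ).mkQ (lmul ω N (zH ω) (u ⊗ₜ[k] n)) = (relN ω N l ζ).mkQ (u ⊗ₜ[k] ζ n)
  rw [lmul_tmul, hz]
  exact this

theorem inducedRep_zH_unit (n : N) :
    inducedRep ω N l ζ (zH ω) (inducedUnit ω N l ζ n) = inducedUnit ω N l ζ (ζ n) := by
  rw [inducedRep_zH]
  rfl

theorem exists_inducedRep_zH_inverse (hζ : Function.Bijective ζ) :
    ∃ Zi : Module.End k (InducedModule ω N l ζ),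
      Zi * inducedRep ω N l ζ (zH ω) = 1 ∧ inducedRep ω N l ζ (zH ω) * Zi = 1 := by
  let e := LinearEquiv.ofBijective ζ hζ
  have h1 : ∀ n, e.symm (ζ n) = n := e.symm_apply_apply
  have h2 : ∀ n, ζ (e.symm n) = n := e.apply_symm_apply
  have hc : Commute (e.symm : Module.End k N) ζ := LinearMap.ext fun n => by
    change e.symm (ζ n) = ζ (e.symm n)
    rw [h1, h2]
  refine ⟨(relN ω N l ζ).mapQ _ ((e.symm : Module.End k N).lTensor _)
    (relN_le_comap_lTensor ω N l ζ hc), ?_, ?_⟩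
  · rw [inducedRep_zH]
    ext u n
    simp [h1]
  · rw [inducedRep_zH]
    ext u n
    simp [h2]

/-- The induced module is generated by the image of the unit. -/
theorem induced_eq_top {S : Submodule k (InducedModule ω N l ζ)}
    (hN : LinearMap.range (inducedUnit ω N l ζ) ≤ S)
    (hS : ∀ h : Heisenberg ω, ∀ m ∈ S, inducedRep ω N l ζ h m ∈ S) : S = ⊤ := by
  let φ := UniversalEnvelopingAlgebra.lift k (inducedRep ω N l ζ)
  have hφ : ∀ u v n, φ u ((relN ω N l ζ).mkQ (v ⊗ₜ[k] n)) =
      (relN ω N l ζ).mkQ ((u * v) ⊗ₜ[k] n) := by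
    let A : Subalgebra k (UniversalEnvelopingAlgebra k (Heisenberg ω)) :=
      { carrier := {u | ∀ v n, φ u ((relN ω N l ζ).mkQ (v ⊗ₜ[k] n)) =
          (relN ω N l ζ).mkQ ((u * v) ⊗ₜ[k] n)}
        mul_mem' := fun {a b} ha hb v n => by
          rw [map_mul, Module.End.mul_apply, hb, ha, mul_assoc]
        add_mem' := fun {a b} ha hb v n => by
          rw [map_add, LinearMap.add_apply, ha, hb, add_mul, TensorProduct.add_tmul, map_add]
        algebraMap_mem' := fun c v n => by
          rw [AlgHom.commutes, Module.algebraMap_end_apply, ← map_smul,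
            Algebra.algebraMap_eq_smul_one, smul_mul_assoc, one_mul, TensorProduct.smul_tmul'] }
    have hA : A = ⊤ := UniversalEnvelopingAlgebra.subalgebra_eq_top A fun h v n => by
      simp only [φ, UniversalEnvelopingAlgebra.lift_ι_apply, inducedRep_mk, lmul_tmul]
    intro u
    exact (hA ▸ Algebra.mem_top : u ∈ A)
  have hφS : ∀ u, ∀ m ∈ S, φ u m ∈ S := by
    let A : Subalgebra k (UniversalEnvelopingAlgebra k (Heisenberg ω)) :=
      { carrier := {u | ∀ m ∈ S, φ u m ∈ S}
        mul_mem' := fun {a b} ha hb m hm => by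
          rw [map_mul, Module.End.mul_apply]; exact ha _ (hb _ hm)
        add_mem' := fun {a b} ha hb m hm => by
          rw [map_add, LinearMap.add_apply]; exact S.add_mem (ha _ hm) (hb _ hm)
        algebraMap_mem' := fun c m hm => by
          rw [AlgHom.commutes, Module.algebraMap_end_apply]; exact S.smul_mem _ hm }
    have hA : A = ⊤ := UniversalEnvelopingAlgebra.subalgebra_eq_top A fun h m hm => by
      simp only [φ, UniversalEnvelopingAlgebra.lift_ι_apply]
      exact hS h m hm
    intro u
    exact (hA ▸ Algebra.mem_top : u ∈ A)
  rw [eq_top_iff]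
  rintro q -
  obtain ⟨t, rfl⟩ := (relN ω N l ζ).mkQ_surjective q
  induction t using TensorProduct.induction_on with
  | zero => rw [map_zero]; exact S.zero_mem
  | add s t hs ht => rw [map_add]; exact S.add_mem hs ht
  | tmul u n =>
    rw [← mul_one u, ← hφ]
    exact hφS u _ (hN ⟨n, rfl⟩)

variable {ω N} {W : Type*} [AddCommGroup W] [Module k W]
  (ρ : Heisenberg ω →ₗ⁅k⁆ Module.End k W) (f : N →ₗ[k] W)

/-- The map `u ⊗ n ↦ u · f n`. -/
noncomputable def actionMap : UniversalEnvelopingAlgebra k (Heisenberg ω) ⊗[k] N →ₗ[k] W :=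
  TensorProduct.lift (LinearMap.lcomp k W f ∘ₗ (UniversalEnvelopingAlgebra.lift k ρ).toLinearMap)

theorem actionMap_tmul (u : UniversalEnvelopingAlgebra k (Heisenberg ω)) (n : N) :
    actionMap ρ f (u ⊗ₜ[k] n) = UniversalEnvelopingAlgebra.lift k ρ u (f n) := rfl

theorem actionMap_lmul (h : Heisenberg ω)
    (t : UniversalEnvelopingAlgebra k (Heisenberg ω) ⊗[k] N) :
    actionMap ρ f (lmul ω N h t) = ρ h (actionMap ρ f t) := by
  induction t using TensorProduct.induction_on with
  | zero => simp
  | add s t hs ht => rw [map_add, map_add, hs, ht, map_add, map_add]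
  | tmul u n =>
    rw [lmul_tmul, actionMap_tmul, actionMap_tmul, map_mul,
      UniversalEnvelopingAlgebra.lift_ι_apply, Module.End.mul_apply]

variable {l ζ ρ f}

theorem relN_le_ker_actionMap (hl : ∀ x ∈ l, ∀ n, ρ (ofV ω x) (f n) = 0)
    (hz : ∀ n, ρ (zH ω) (f n) = f (ζ n)) : relN ω N l ζ ≤ LinearMap.ker (actionMap ρ f) := by
  refine Submodule.span_le.2 ?_
  rintro _ ⟨u, x, hx, c, n, rfl⟩
  have h : ρ (ofVk ω x c) (f n) = f (c • ζ n) := by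
    rw [eq_ofV_add_smul_zH ω (ofVk ω x c), map_add, map_smul, LinearMap.add_apply,
      LinearMap.smul_apply, hz, map_smul]
    change ρ (ofV ω x) (f n) + c • f (ζ n) = _
    rw [hl x hx, zero_add]
  rw [SetLike.mem_coe, LinearMap.mem_ker, map_sub, actionMap_tmul, actionMap_tmul, map_mul,
    UniversalEnvelopingAlgebra.lift_ι_apply, Module.End.mul_apply, h, sub_self]

end Induced

namespace LagrangianFrame

variable {ω : AltBilin k V} {l : Submodule k V} {ι : Type*} [Fintype ι] [DecidableEq ι]
  (F : LagrangianFrame ω l ι)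

section Induced

variable {N : Type*} [AddCommGroup N] [Module k N] {ζ : Module.End k N}
  {Zi : Module.End k (InducedModule ω N l ζ)}

theorem derivation_unit (i : ι) :
    ∀ m ∈ LinearMap.range (inducedUnit ω N l ζ),
      F.derivation (inducedRep ω N l ζ) Zi i m = 0 := by
  rintro _ ⟨n, rfl⟩
  rw [derivation, Module.End.mul_apply, inducedRep_ofV_unit ω N l ζ (F.x_mem i), map_zero]

theorem iSup_weylDegree_induced (h₁ : Zi * inducedRep ω N l ζ (zH ω) = 1)
    (h₂ : inducedRep ω N l ζ (zH ω) * Zi = 1) :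
    ⨆ d, weylDegree (fun j => inducedRep ω N l ζ (ofV ω (F.y j)))
      (LinearMap.range (inducedUnit ω N l ζ)) d = ⊤ := by
  refine iSup_weylDegree_eq_top (F.derivation_mul h₁ h₂) F.derivation_unit
    (fun j => rep_zH_commute (inducedRep ω N l ζ) _) ?_ fun S hN hD hY hZ =>
      induced_eq_top ω N l ζ hN fun h m hm => F.rep_mem h₂ hD hY hZ h hm
  rintro _ ⟨n, rfl⟩
  exact ⟨ζ n, (inducedRep_zH_unit ω N l ζ n).symm⟩

theorem induced_invariants_le [CharZero k] (h₁ : Zi * inducedRep ω N l ζ (zH ω) = 1)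
    (h₂ : inducedRep ω N l ζ (zH ω) * Zi = 1) {m : InducedModule ω N l ζ}
    (hm : ∀ i, F.derivation (inducedRep ω N l ζ) Zi i m = 0) :
    ∃ n, inducedUnit ω N l ζ n = m :=
  weyl_invariants_le (F.derivation_mul h₁ h₂) (F.rep_y_commute _) F.derivation_unit
    (F.iSup_weylDegree_induced h₁ h₂) hm

include F in
theorem eq_zero_of_inducedUnit_eq_zero
    (hLag : ∀ v : V, v ∈ l ↔ ∀ x ∈ l, ω.form v x = 0) {n : N}
    (hn : inducedUnit ω N l ζ n = 0) : n = 0 := by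
  have hle : relN ω N l ζ ≤ LinearMap.ker
      (actionMap (F.powerSeriesRep N ζ) (LinearMap.single k (fun _ : ι → ℕ => N) 0)) := by
    refine relN_le_ker_actionMap (fun x hx n => F.powerSeriesRep_ofV_single N ζ hLag hx n) ?_
    intro n
    ext a
    rw [powerSeriesRep_zH]
    by_cases ha : a = 0
    · subst ha; simp
    · simp [ha]
  have := hle ((Submodule.Quotient.mk_eq_zero _).1 hn)
  rw [LinearMap.mem_ker, TensorProduct.mk_apply, actionMap_tmul, map_one] at this
  simpa using congrFun this 0

include F in
/-- A morphism out of the induced module that is injective on the unit is injective. -/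
theorem ker_actionMap_le [CharZero k] {W : Type*} [AddCommGroup W] [Module k W]
    {ρ : Heisenberg ω →ₗ⁅k⁆ Module.End k W} {f : N →ₗ[k] W} (hζ : Function.Bijective ζ)
    (hρ : Function.Injective (ρ (zH ω))) (hf : Function.Injective f)
    (hle : relN ω N l ζ ≤ LinearMap.ker (actionMap ρ f)) :
    LinearMap.ker (actionMap ρ f) ≤ relN ω N l ζ := by
  obtain ⟨Zi, h₁, h₂⟩ := exists_inducedRep_zH_inverse ω N l ζ hζ
  let α : InducedModule ω N l ζ →ₗ[k] W := (relN ω N l ζ).liftQ (actionMap ρ f) hle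
  have hα : ∀ h q, α (inducedRep ω N l ζ h q) = ρ h (α q) := by
    intro h q
    obtain ⟨t, rfl⟩ := (relN ω N l ζ).mkQ_surjective q
    exact actionMap_lmul ρ f h t
  have hstab : ∀ h, ∀ q ∈ LinearMap.ker α, inducedRep ω N l ζ h q ∈ LinearMap.ker α := by
    intro h q hq
    rw [LinearMap.mem_ker] at hq ⊢
    rw [hα, hq, map_zero]
  have hZi : ∀ q ∈ LinearMap.ker α, Zi q ∈ LinearMap.ker α := by
    intro q hq
    rw [LinearMap.mem_ker] at hq ⊢
    apply hρ
    rw [← hα, ← Module.End.mul_apply, h₂, Module.End.one_apply, hq, map_zero]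
  have hker : LinearMap.ker α ≤ ⊥ := by
    refine weyl_le_of_invariants_le (F.derivation_mul h₁ h₂) (F.derivation_commute h₁ h₂)
      (fun i m hm => hZi _ (hstab _ m hm)) (fun i => hstab _) ?_ ?_ ?_
    · intro i m hm
      rw [Submodule.mem_bot] at hm ⊢
      rw [hm, map_zero]
    · exact fun i m _ => weyl_exists_pow_apply_eq_zero (F.derivation_mul h₁ h₂)
        F.derivation_unit (F.iSup_weylDegree_induced h₁ h₂) i m
    · intro m hm hD
      obtain ⟨n, rfl⟩ := F.induced_invariants_le h₁ h₂ hD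
      have hn : f n = 0 := by
        have : actionMap ρ f (1 ⊗ₜ[k] n) = 0 := hm
        rwa [actionMap_tmul, map_one] at this
      rw [Submodule.mem_bot, (map_eq_zero_iff f hf).1 hn, map_zero]
  intro t ht
  exact (Submodule.Quotient.mk_eq_zero _).1 ((Submodule.mem_bot k).1 (hker ht))

end Induced

include F in
/-- If every vector killed by `l` is in the range of `f`, and `l` acts locally nilpotently, then
the range of `f` generates the representation. -/
theorem actionMap_surjective [CharZero k] (hLag : ∀ v : V, v ∈ l ↔ ∀ x ∈ l, ω.form v x = 0)
    {N W : Type*} [AddCommGroup N] [Module k N] [AddCommGroup W] [Module k W]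
    {ρ : Heisenberg ω →ₗ⁅k⁆ Module.End k W} {f : N →ₗ[k] W}
    (hρ : Function.Bijective (ρ (zH ω)))
    (hnil : ∀ x ∈ l, ∀ m, ∃ n : ℕ, (ρ (ofV ω x) ^ n) m = 0)
    (hf : ∀ m, (∀ x ∈ l, ρ (ofV ω x) m = 0) → m ∈ LinearMap.range f) :
    Function.Surjective (actionMap ρ f) := by
  let e := LinearEquiv.ofBijective (ρ (zH ω)) hρ
  let Zi : Module.End k W := e.symm
  have h₁ : Zi * ρ (zH ω) = 1 := LinearMap.ext e.symm_apply_apply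
  have h₂ : ρ (zH ω) * Zi = 1 := LinearMap.ext e.apply_symm_apply
  rw [← LinearMap.range_eq_top, eq_top_iff]
  refine weyl_le_of_invariants_le (F.derivation_mul h₁ h₂) (F.derivation_commute h₁ h₂)
    (fun _ _ _ => Submodule.mem_top) (fun _ _ _ => Submodule.mem_top) ?_ ?_ ?_
  · rintro i _ ⟨t, rfl⟩
    exact ⟨_, actionMap_lmul ρ f _ t⟩
  · intro i m _
    obtain ⟨n, hn⟩ := hnil _ (F.x_mem i) m
    refine ⟨n, ?_⟩
    rw [derivation, (commute_inv h₁ h₂ _).mul_pow, Module.End.mul_apply, hn, map_zero]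
  · intro m _ hD
    obtain ⟨n, rfl⟩ := hf m fun x hx => F.rep_ofV_apply_eq_zero ρ hLag
      (fun i => by rw [F.rep_x_apply h₂, hD, map_zero]) hx
    exact ⟨1 ⊗ₜ[k] n, by rw [actionMap_tmul, map_one, Module.End.one_apply]⟩

end LagrangianFrame

theorem lie_zH_comm (ω : AltBilin k V) {M : Type*} [AddCommGroup M]
    [LieRingModule (Heisenberg ω) M] (h : Heisenberg ω) (m : M) :
    ⁅h, ⁅zH ω, m⁆⁆ = ⁅zH ω, ⁅h, m⁆⁆ := by
  rw [leibniz_lie (zH ω) h m, zH_lie, zero_lie, zero_add]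

section Invariants

variable (ω : AltBilin k V) (M : Type*) [AddCommGroup M] [Module k M]
  [LieRingModule (Heisenberg ω) M] [LieModule k (Heisenberg ω) M] (l : Submodule k V)

/-- The action of the central element on the invariants. -/
def invZ : Module.End k (invSub ω M l) :=
  (LieModule.toEnd k (Heisenberg ω) M (zH ω)).restrict fun m hm x hx => by
    rw [LieModule.toEnd_apply_apply, lie_zH_comm, hm x hx, lie_zero]

variable {M} in
theorem invZ_bijective (hz : Function.Bijective fun m : M => ⁅zH ω, m⁆) :
    Function.Bijective (invZ ω M l) := by
  refine ⟨fun a b hab => Subtype.ext (hz.1 (congrArg Subtype.val hab)), fun b => ?_⟩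
  obtain ⟨m, hm⟩ := hz.2 b
  have hm : ⁅zH ω, m⁆ = b := hm
  refine ⟨⟨m, fun x hx => hz.1 ?_⟩, Subtype.ext hm⟩
  change ⁅zH ω, ⁅ofV ω x, m⁆⁆ = ⁅zH ω, (0 : M)⁆
  rw [← lie_zH_comm, hm, b.2 x hx, lie_zero]

theorem relSub_eq_relN : relSub ω M l = relN ω (invSub ω M l) l (invZ ω M l) := by
  refine congrArg (Submodule.span k) (Set.ext fun t => ?_)
  constructor
  · rintro ⟨u, x, hx, c, m, m', hm', rfl⟩
    refine ⟨u, x, hx, c, m, ?_⟩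
    rw [show m' = c • invZ ω M l m from Subtype.ext hm']
  · rintro ⟨u, x, hx, c, m, rfl⟩
    exact ⟨u, x, hx, c, m, _, rfl, rfl⟩

theorem alphaMap_eq_actionMap : alphaMap ω M l =
    actionMap (LieModule.toEnd k (Heisenberg ω) M) (invSub ω M l).subtype := by
  ext u m
  rfl

variable {ω M l} [CharZero k] {ι : Type*} [Fintype ι] [DecidableEq ι]

theorem LagrangianFrame.counit_isIso (F : LagrangianFrame ω l ι)
    (hLag : ∀ v : V, v ∈ l ↔ ∀ x ∈ l, ω.form v x = 0)
    (hnil : ∀ x ∈ l, ∀ m : M, ∃ i : ℕ, (fun m' : M => ⁅ofV ω x, m'⁆)^[i] m = 0)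
    (hz : Function.Bijective fun m : M => ⁅zH ω, m⁆) :
    (∀ (h : Heisenberg ω) (u : UniversalEnvelopingAlgebra k (Heisenberg ω)) (m : invSub ω M l),
      alphaMap ω M l ((UniversalEnvelopingAlgebra.ι k h * u) ⊗ₜ[k] m) =
        ⁅h, alphaMap ω M l (u ⊗ₜ[k] m)⁆) ∧
    LinearMap.ker (alphaMap ω M l) = relSub ω M l ∧ Function.Surjective (alphaMap ω M l) := by
  rw [alphaMap_eq_actionMap, relSub_eq_relN]
  have hle : relN ω (invSub ω M l) l (invZ ω M l) ≤ LinearMap.ker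
      (actionMap (LieModule.toEnd k (Heisenberg ω) M) (invSub ω M l).subtype) :=
    relN_le_ker_actionMap (fun x hx n => n.2 x hx) fun n => rfl
  refine ⟨fun h u m => ?_, le_antisymm ?_ hle, ?_⟩
  · rw [← lmul_tmul, actionMap_lmul, LieModule.toEnd_apply_apply]
  · exact F.ker_actionMap_le (invZ_bijective ω l hz) hz.1 Subtype.val_injective hle
  · refine F.actionMap_surjective hLag hz (fun x hx m => ?_) fun m hm => ⟨⟨m, hm⟩, rfl⟩
    obtain ⟨n, hn⟩ := hnil x hx m
    refine ⟨n, ?_⟩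
    rw [Module.End.pow_apply]
    exact hn

theorem LagrangianFrame.unit_isIso (F : LagrangianFrame ω l ι)
    (hLag : ∀ v : V, v ∈ l ↔ ∀ x ∈ l, ω.form v x = 0)
    {N : Type*} [AddCommGroup N] [Module k N] {ζ : Module.End k N} (hζ : Function.Bijective ζ) :
    (∀ (n : N) (x : V), x ∈ l → lmul ω N (ofV ω x) (1 ⊗ₜ[k] n) ∈ relN ω N l ζ) ∧
    (∀ n : N, lmul ω N (zH ω) (1 ⊗ₜ[k] n) - 1 ⊗ₜ[k] (ζ n) ∈ relN ω N l ζ) ∧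
    (∀ n : N, 1 ⊗ₜ[k] n ∈ relN ω N l ζ → n = 0) ∧
    (∀ t : UniversalEnvelopingAlgebra k (Heisenberg ω) ⊗[k] N,
      (∀ x ∈ l, lmul ω N (ofV ω x) t ∈ relN ω N l ζ) →
        ∃ n : N, t - 1 ⊗ₜ[k] n ∈ relN ω N l ζ) := by
  refine ⟨fun n x hx => (Submodule.Quotient.mk_eq_zero _).1 (inducedRep_ofV_unit ω N l ζ hx n),
    fun n => (Submodule.Quotient.eq _).1 (inducedRep_zH_unit ω N l ζ n),
    fun n hn => F.eq_zero_of_inducedUnit_eq_zero hLag ((Submodule.Quotient.mk_eq_zero _).2 hn),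
    fun t ht => ?_⟩
  obtain ⟨Zi, h₁, h₂⟩ := exists_inducedRep_zH_inverse ω N l ζ hζ
  obtain ⟨n, hn⟩ := F.induced_invariants_le h₁ h₂ (m := (relN ω N l ζ).mkQ t) fun i => by
    have : inducedRep ω N l ζ (ofV ω (F.x i)) ((relN ω N l ζ).mkQ t) = 0 :=
      (Submodule.Quotient.mk_eq_zero _).2 (ht _ (F.x_mem i))
    rw [LagrangianFrame.derivation, Module.End.mul_apply, this, map_zero]
  exact ⟨n, (Submodule.Quotient.eq _).1 hn.symm⟩

end Invariants

end HeisenbergRepresentations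

/-- Theorem A: the functors
`F : 𝓜_𝔩(𝔥)^× → 𝓜(𝔷)^×`, `F(M) = M^𝔩`, and
`G : 𝓜(𝔷)^× → 𝓜_𝔩(𝔥)^×`, `G(N) = U(𝔥) ⊗_{U(𝔭)} E(N)`,
are mutually quasi-inverse, so the categories `𝓜_𝔩(𝔥)^×` and `𝓜(𝔷)^×` are
equivalent. Concretely: (a) for every `𝔥`-module `M` on which `𝔩` acts locally
nilpotently and `z` acts invertibly, the counit `G(F(M)) → M`, `u ⊗ m ↦ u·m`
(here `G(F(M))` is presented as the quotient of `U(𝔥) ⊗_k M^𝔩` by the relation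
submodule `relSub`) is an isomorphism of `𝔥`-modules: it is `𝔥`-equivariant,
has kernel exactly `relSub`, and is surjective; and (b) for every `𝔷`-module
`N` on which `z` acts invertibly (by `ζ`), the unit `N → F(G(N)) = G(N)^𝔩`,
`n ↦ 1 ⊗ n` (with `G(N)` presented as the quotient of `U(𝔥) ⊗_k N` by `relN`)
is an isomorphism of `𝔷`-modules: `1 ⊗ n` is `𝔩`-invariant mod relations, the
map intertwines `ζ` with the `z`-action, it is injective mod relations, and
every `𝔩`-invariant-mod-relations element is congruent to some `1 ⊗ n`. -/
theorem stmt0 {k V : Type*} [Field k] [CharZero k] [AddCommGroup V] [Module k V]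
    [FiniteDimensional k V] (ω : AltBilin k V)
    (hnondeg : ∀ v : V, (∀ w : V, ω.form v w = 0) → v = 0)
    (l : Submodule k V) (hLag : ∀ v : V, v ∈ l ↔ ∀ x ∈ l, ω.form v x = 0) :
    (∀ (M : Type*) [AddCommGroup M] [Module k M]
        [LieRingModule (Heisenberg ω) M] [LieModule k (Heisenberg ω) M],
      (∀ x ∈ l, ∀ m : M,
          ∃ i : ℕ, (fun m' : M => ⁅Heisenberg.ofV ω x, m'⁆)^[i] m = 0) →
      (Function.Bijective fun m : M => ⁅Heisenberg.zH ω, m⁆) →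
      ((∀ (h : Heisenberg ω) (u : UniversalEnvelopingAlgebra k (Heisenberg ω))
          (m : ↥(invSub ω M l)),
          alphaMap ω M l ((UniversalEnvelopingAlgebra.ι k h * u) ⊗ₜ[k] m)
            = ⁅h, alphaMap ω M l (u ⊗ₜ[k] m)⁆)
        ∧ LinearMap.ker (alphaMap ω M l) = relSub ω M l
        ∧ Function.Surjective (alphaMap ω M l)))
    ∧ (∀ (N : Type*) [AddCommGroup N] [Module k N] (ζ : Module.End k N),
      Function.Bijective ζ →
      ((∀ (n : N) (x : V), x ∈ l →
          lmul ω N (Heisenberg.ofV ω x)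
              ((1 : UniversalEnvelopingAlgebra k (Heisenberg ω)) ⊗ₜ[k] n)
            ∈ relN ω N l ζ)
        ∧ (∀ n : N,
            lmul ω N (Heisenberg.zH ω)
                ((1 : UniversalEnvelopingAlgebra k (Heisenberg ω)) ⊗ₜ[k] n)
              - (1 : UniversalEnvelopingAlgebra k (Heisenberg ω)) ⊗ₜ[k] (ζ n)
            ∈ relN ω N l ζ)
        ∧ (∀ n : N,
            (1 : UniversalEnvelopingAlgebra k (Heisenberg ω)) ⊗ₜ[k] n ∈ relN ω N l ζ
              → n = 0)
        ∧ (∀ t : UniversalEnvelopingAlgebra k (Heisenberg ω) ⊗[k] N,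
            (∀ x ∈ l, lmul ω N (Heisenberg.ofV ω x) t ∈ relN ω N l ζ) →
            ∃ n : N,
              t - (1 : UniversalEnvelopingAlgebra k (Heisenberg ω)) ⊗ₜ[k] n
                ∈ relN ω N l ζ))) := by
  obtain ⟨F⟩ := exists_lagrangianFrame ω hnondeg l hLag
  exact ⟨fun M _ _ _ _ hnil hz => F.counit_isIso hLag hnil hz,
    fun N _ _ ζ hζ => F.unit_isIso hLag hζ⟩
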